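/- Let q ≡ 1 (mod 5), let φ' be a nontrivial additive character of F_p with values in ℂ, and for each r ≥ 1 set φ_r = φ' ∘ Tr_{F_{q^r}/F_p}. Then for every r ≥ 1, as complex numbers, the number of pairs (x,y) ∈ F_{q^r} × F_{q^r} with y^5 = x^4(1-x)^3 equals q^r − Σ_χ ( −(1/q)·G(φ_1,χ)^2·G(φ_1,χ^3) )^r, where the sum runs over all nontrivial multiplicative characters χ of F_q^* with χ^5 = 1. -/

import Mathlib

noncomputable instance (p n : ℕ) [Fact p.Prime] : Fintype (GaloisField p n) :=
  Fintype.ofFinite _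

/-- The group of multiplicative characters of a finite field with values in `ℂ` is finite. -/
noncomputable instance {F : Type*} [Field F] [Fintype F] : Fintype (MulChar F ℂ) :=
  Fintype.ofFinite _

/-- The Gauss sum `G(φ, χ) = ∑_{x ∈ F*} φ(x) χ(x)`. -/
noncomputable def gaussSum' {F : Type*} [Field F] [Fintype F]
    (φ : AddChar F ℂ) (χ : MulChar F ℂ) : ℂ :=
  letI := Classical.decEq F
  ∑ x : Fˣ, φ (x : F) * χ (x : F)

section HasseDavenport

open Polynomial Finset UniqueFactorizationMonoid IntermediateField

variable {F : Type*} [Field F]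

/-- The multiplicative function `f ↦ ψ (c₁) χ (c_d)` on monic polynomials
`f = X ^ d - c₁ X ^ (d - 1) + ⋯ + (-1) ^ d c_d`. -/
noncomputable def polyChar (χ : MulChar F ℂ) (ψ : AddChar F ℂ) (f : F[X]) : ℂ :=
  ψ (-f.nextCoeff) * χ ((-1) ^ f.natDegree * f.coeff 0)

lemma polyChar_one (χ : MulChar F ℂ) (ψ : AddChar F ℂ) : polyChar χ ψ 1 = 1 := by
  have : (1 : F[X]).nextCoeff = 0 := nextCoeff_C_eq_zero 1
  simp [polyChar, this]

lemma polyChar_mul (χ : MulChar F ℂ) (ψ : AddChar F ℂ) {f g : F[X]} (hf : f.Monic)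
    (hg : g.Monic) : polyChar χ ψ (f * g) = polyChar χ ψ f * polyChar χ ψ g := by
  simp only [polyChar, hf.nextCoeff_mul hg, hf.natDegree_mul hg, mul_coeff_zero, neg_add,
    AddChar.map_add_eq_mul, pow_add, map_mul]
  ring

lemma polyChar_pow (χ : MulChar F ℂ) (ψ : AddChar F ℂ) {f : F[X]} (hf : f.Monic) (m : ℕ) :
    polyChar χ ψ (f ^ m) = polyChar χ ψ f ^ m := by
  induction m with
  | zero => simp [polyChar_one]
  | succ m ih => rw [pow_succ, polyChar_mul χ ψ (hf.pow m) hf, ih, pow_succ]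

lemma polyChar_minpoly_pow {L : Type*} [Field L] [Algebra F L] [FiniteDimensional F L]
    (χ : MulChar F ℂ) (ψ : AddChar F ℂ) (α : L) :
    polyChar χ ψ (minpoly F α) ^ (Module.finrank F L / (minpoly F α).natDegree)
      = ψ (Algebra.trace F L α) * χ (Algebra.norm F α) := by
  have hi : IsIntegral F α := .of_finite F α
  have hdeg : Module.finrank F L / (minpoly F α).natDegree = Module.finrank F⟮α⟯ L := by
    rw [← IntermediateField.adjoin.finrank hi, ← Module.finrank_mul_finrank F F⟮α⟯ L,
      Nat.mul_div_cancel_left _ Module.finrank_pos]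
  have hnorm : Algebra.norm F α = ((-1) ^ (minpoly F α).natDegree * (minpoly F α).coeff 0)
      ^ Module.finrank F⟮α⟯ L := by
    have h := Algebra.PowerBasis.norm_gen_eq_coeff_zero_minpoly (adjoin.powerBasis hi)
    rw [IntermediateField.adjoin.powerBasis_gen, IntermediateField.minpoly_gen,
      IntermediateField.adjoin.powerBasis_dim] at h
    rw [← h, Algebra.norm_eq_norm_adjoin]
  rw [hdeg, trace_eq_finrank_mul_minpoly_nextCoeff, hnorm, polyChar, mul_pow, map_pow,
    ← nsmul_eq_mul, AddChar.map_nsmul_eq_pow]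

variable (F) [Fintype F]

lemma finite_monic_natDegree_eq (d : ℕ) : {f : F[X] | f.Monic ∧ f.natDegree = d}.Finite := by
  refine Set.Finite.of_injOn (f := fun (f : F[X]) (i : Fin (d + 1)) => f.coeff i)
    (t := Set.univ) (fun _ _ => Set.mem_univ _) ?_ Set.finite_univ
  rintro f ⟨-, hf⟩ g ⟨-, hg⟩ h
  ext i
  by_cases hi : i < d + 1
  · exact congrFun h ⟨i, hi⟩
  · rw [coeff_eq_zero_of_natDegree_lt (by omega), coeff_eq_zero_of_natDegree_lt (by omega)]

/-- The monic polynomials of degree `d` over a finite field. -/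
noncomputable def monicsOfDegree (d : ℕ) : Finset F[X] := (finite_monic_natDegree_eq F d).toFinset

open scoped Classical in
/-- The monic irreducible polynomials of degree dividing `k` over a finite field
(for `k ≠ 0`). -/
noncomputable def monicIrreducibles (k : ℕ) : Finset F[X] :=
  {P ∈ (range (k + 1)).biUnion (monicsOfDegree F) | Irreducible P ∧ P.natDegree ∣ k}

variable {F}

@[simp] lemma mem_monicsOfDegree {d : ℕ} {f : F[X]} :
    f ∈ monicsOfDegree F d ↔ f.Monic ∧ f.natDegree = d := by
  simp [monicsOfDegree]

lemma mem_monicIrreducibles {k : ℕ} (hk : k ≠ 0) {P : F[X]} :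
    P ∈ monicIrreducibles F k ↔ P.Monic ∧ Irreducible P ∧ P.natDegree ∣ k := by
  simp only [monicIrreducibles, mem_filter, mem_biUnion, mem_range, mem_monicsOfDegree]
  constructor
  · rintro ⟨⟨d, -, h, -⟩, h'⟩
    exact ⟨h, h'⟩
  · rintro ⟨h, h'⟩
    exact ⟨⟨_, Nat.lt_succ_of_le (Nat.le_of_dvd (Nat.pos_of_ne_zero hk) h'.2), h, rfl⟩, h'⟩

open scoped Classical in
lemma sum_natDegree_pow_dvd {d : ℕ} {f : F[X]} (hf : f ∈ monicsOfDegree F d) :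
    ∑ k ∈ Icc 1 d, ∑ P ∈ monicIrreducibles F k with P ^ (k / P.natDegree) ∣ f, P.natDegree
      = d := by
  rw [mem_monicsOfDegree] at hf
  obtain ⟨hf, rfl⟩ := hf
  have hf0 := hf.ne_zero
  have hnf {P : F[X]} (hP : P ∈ normalizedFactors f) : P.Monic ∧ Irreducible P := by
    have h := irreducible_of_normalized_factor P hP
    refine ⟨?_, h⟩
    rw [← normalize_normalized_factor P hP]
    exact monic_normalize h.ne_zero
  have hcount {P : F[X]} (hP : P.Monic) (hi : Irreducible P) (m : ℕ) :
      P ^ m ∣ f ↔ m ≤ (normalizedFactors f).count P := by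
    rw [pow_dvd_iff_le_emultiplicity, emultiplicity_eq_count_normalizedFactors hi hf0,
      hP.normalize_eq_self]
    simp
  have hprod : (normalizedFactors f).prod = f := by
    have := prod_normalizedFactors_eq hf0
    rwa [hf.normalize_eq_self] at this
  have hdeg : f.natDegree = ∑ P ∈ (normalizedFactors f).toFinset,
      ∑ _m ∈ Icc 1 ((normalizedFactors f).count P), P.natDegree := by
    conv_lhs => rw [← hprod]
    rw [natDegree_multiset_prod_of_monic _ fun P hP => (hnf hP).1, Finset.sum_multiset_map_count]
    simp
  conv_rhs => rw [hdeg]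
  rw [Finset.sum_sigma', Finset.sum_sigma']
  refine Finset.sum_bij' (fun x _ => ⟨x.2, x.1 / x.2.natDegree⟩)
    (fun y _ => ⟨y.2 * y.1.natDegree, y.1⟩) ?_ ?_ ?_ ?_ ?_
  · rintro ⟨k, P⟩ h
    simp only [mem_sigma, mem_Icc, mem_filter] at h
    obtain ⟨⟨h1, h2⟩, h3, h4⟩ := h
    rw [mem_monicIrreducibles (by omega)] at h3
    obtain ⟨hP, hi, hd⟩ := h3
    have hpos : 1 ≤ k / P.natDegree := Nat.div_pos (Nat.le_of_dvd h1 hd) hi.natDegree_pos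
    rw [hcount hP hi] at h4
    simp only [mem_sigma, mem_Icc, Multiset.mem_toFinset]
    exact ⟨Multiset.count_pos.1 (by omega), hpos, h4⟩
  · rintro ⟨P, m⟩ h
    simp only [mem_sigma, mem_Icc, Multiset.mem_toFinset] at h
    obtain ⟨h1, h2, h3⟩ := h
    obtain ⟨hP, hi⟩ := hnf h1
    have hpos := hi.natDegree_pos
    have hk : 1 ≤ m * P.natDegree := Nat.mul_pos h2 hpos
    rw [← hcount hP hi] at h3
    simp only [mem_sigma, mem_Icc, mem_filter]
    refine ⟨⟨hk, ?_⟩, ?_, ?_⟩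
    · rw [← natDegree_pow]
      exact natDegree_le_of_dvd h3 hf0
    · rw [mem_monicIrreducibles (by omega)]
      exact ⟨hP, hi, dvd_mul_left _ _⟩
    · rwa [Nat.mul_div_cancel _ hpos]
  · rintro ⟨k, P⟩ h
    simp only [mem_sigma, mem_Icc, mem_filter] at h
    obtain ⟨⟨h1, h2⟩, h3, h4⟩ := h
    rw [mem_monicIrreducibles (by omega)] at h3
    simp [Nat.div_mul_cancel h3.2.2]
  · rintro ⟨P, m⟩ h
    simp only [mem_sigma, mem_Icc, Multiset.mem_toFinset] at h
    simp [Nat.mul_div_cancel _ (hnf h.1).2.natDegree_pos]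
  · rintro ⟨k, P⟩ h
    rfl

variable (χ : MulChar F ℂ) (ψ : AddChar F ℂ)

/-- The power sum `∑_P deg P · polyChar P ^ (k / deg P)` over monic irreducible `P` of degree
dividing `k`. -/
noncomputable def irredPowerSum (k : ℕ) : ℂ :=
  ∑ P ∈ monicIrreducibles F k, (P.natDegree : ℂ) * polyChar χ ψ P ^ (k / P.natDegree)

open scoped Classical in
lemma sum_polyChar_of_dvd {d k : ℕ} (hkd : k ≤ d) {Q : F[X]} (hQ : Q ∈ monicsOfDegree F k) :
    ∑ f ∈ monicsOfDegree F d with Q ∣ f, polyChar χ ψ f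
      = polyChar χ ψ Q * ∑ g ∈ monicsOfDegree F (d - k), polyChar χ ψ g := by
  rw [mem_monicsOfDegree] at hQ
  obtain ⟨hQ, rfl⟩ := hQ
  rw [Finset.mul_sum]
  symm
  refine Finset.sum_bij (fun g _ => Q * g) ?_ ?_ ?_ ?_
  · intro g hg
    rw [mem_monicsOfDegree] at hg
    simp only [mem_filter, mem_monicsOfDegree, dvd_mul_right, and_true]
    refine ⟨hQ.mul hg.1, ?_⟩
    rw [hQ.natDegree_mul hg.1]
    omega
  · intro g _ g' _ h
    exact mul_left_cancel₀ hQ.ne_zero h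
  · intro f hf
    simp only [mem_filter, mem_monicsOfDegree] at hf
    obtain ⟨⟨hf, hd⟩, g, rfl⟩ := hf
    have hg : g.Monic := hQ.of_mul_monic_left hf
    rw [hQ.natDegree_mul hg] at hd
    exact ⟨g, mem_monicsOfDegree.2 ⟨hg, by omega⟩, rfl⟩
  · intro g hg
    rw [polyChar_mul χ ψ hQ (mem_monicsOfDegree.1 hg).1]

lemma natCast_mul_sum_polyChar (d : ℕ) :
    (d : ℂ) * ∑ f ∈ monicsOfDegree F d, polyChar χ ψ f
      = ∑ k ∈ Icc 1 d, irredPowerSum χ ψ k * ∑ f ∈ monicsOfDegree F (d - k), polyChar χ ψ f := by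
  classical
  have h1 : ∀ f ∈ monicsOfDegree F d, (d : ℂ) * polyChar χ ψ f =
      ∑ k ∈ Icc 1 d, ∑ P ∈ monicIrreducibles F k,
        if P ^ (k / P.natDegree) ∣ f then (P.natDegree : ℂ) * polyChar χ ψ f else 0 := by
    intro f hf
    have := congrArg (Nat.cast : ℕ → ℂ) (sum_natDegree_pow_dvd hf)
    rw [← this]
    push_cast
    simp only [Finset.sum_mul, Finset.sum_filter]
    refine Finset.sum_congr rfl fun k _ => Finset.sum_congr rfl fun P _ => ?_
    split_ifs <;> simp
  rw [Finset.mul_sum, Finset.sum_congr rfl h1, Finset.sum_comm]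
  refine Finset.sum_congr rfl fun k hk => ?_
  rw [mem_Icc] at hk
  rw [Finset.sum_comm, irredPowerSum, Finset.sum_mul]
  refine Finset.sum_congr rfl fun P hP => ?_
  rw [mem_monicIrreducibles (by omega)] at hP
  obtain ⟨hP, hi, hd⟩ := hP
  rw [← Finset.sum_filter, ← Finset.mul_sum, sum_polyChar_of_dvd χ ψ hk.2, polyChar_pow χ ψ hP,
    mul_assoc]
  rw [mem_monicsOfDegree]
  exact ⟨hP.pow _, by rw [natDegree_pow, Nat.div_mul_cancel hd]⟩

lemma sum_polyChar_zero : ∑ f ∈ monicsOfDegree F 0, polyChar χ ψ f = 1 := by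
  have : monicsOfDegree F 0 = {1} := by
    ext f
    simp only [mem_monicsOfDegree, mem_singleton]
    constructor
    · rintro ⟨h, h'⟩
      exact h.natDegree_eq_zero.1 h'
    · rintro rfl
      simp
  rw [this, Finset.sum_singleton, polyChar_one]

lemma sum_polyChar_degree_one :
    ∑ f ∈ monicsOfDegree F 1, polyChar χ ψ f = gaussSum χ ψ := by
  rw [gaussSum]
  symm
  refine Finset.sum_bij (fun a _ => X - C a) ?_ ?_ ?_ ?_
  · intro a _
    simp [monic_X_sub_C]
  · intro a _ b _ h
    simpa using h
  · intro f hf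
    rw [mem_monicsOfDegree] at hf
    refine ⟨-f.coeff 0, mem_univ _, ?_⟩
    conv_rhs => rw [hf.1.eq_X_add_C hf.2]
    simp
  · intro a _
    simp [polyChar, mul_comm]

variable {ψ}

lemma sum_polyChar_eq_zero (hψ : ψ ≠ 1) {d : ℕ} (hd : 2 ≤ d) :
    ∑ f ∈ monicsOfDegree F d, polyChar χ ψ f = 0 := by
  obtain ⟨t, ht⟩ : ∃ t, ψ t ≠ 1 := AddChar.ne_one_iff.1 hψ
  have hmem (s : F) (f : F[X]) (hf : f ∈ monicsOfDegree F d) :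
      f + C s * X ^ (d - 1) ∈ monicsOfDegree F d := by
    rw [mem_monicsOfDegree] at hf ⊢
    have hlt : (C s * X ^ (d - 1)).degree < f.degree := by
      refine (degree_C_mul_X_pow_le _ _).trans_lt ?_
      rw [degree_eq_natDegree hf.1.ne_zero, hf.2]
      exact_mod_cast (by omega : d - 1 < d)
    exact ⟨hf.1.add_of_left hlt, by rw [natDegree_add_eq_left_of_degree_lt hlt, hf.2]⟩
  have key : ∑ f ∈ monicsOfDegree F d, polyChar χ ψ f
      = ψ t * ∑ f ∈ monicsOfDegree F d, polyChar χ ψ f := by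
    conv_rhs => rw [Finset.mul_sum]
    refine Finset.sum_bij' (fun f _ => f + C t * X ^ (d - 1))
      (fun f _ => f + C (-t) * X ^ (d - 1)) (hmem _) (hmem _) ?_ ?_ ?_
    · intro f _
      simp
    · intro f _
      simp
    · intro f hf
      have h2 := hmem t f hf
      rw [mem_monicsOfDegree] at hf h2
      rw [polyChar, polyChar, h2.2, hf.2, nextCoeff_of_natDegree_pos (by omega),
        nextCoeff_of_natDegree_pos (by omega), h2.2, hf.2, ← mul_assoc,
        ← AddChar.map_add_eq_mul]
      have h0 : d - 1 ≠ 0 := by omega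
      simp [coeff_X_pow, h0.symm]
  have : (1 - ψ t) * ∑ f ∈ monicsOfDegree F d, polyChar χ ψ f = 0 := by
    rw [sub_mul, one_mul, sub_eq_zero]
    exact key
  exact (mul_eq_zero.1 this).resolve_left (sub_ne_zero.2 ht.symm)

lemma irredPowerSum_succ (hψ : ψ ≠ 1) (r : ℕ) :
    irredPowerSum χ ψ (r + 1) = -(-gaussSum χ ψ) ^ (r + 1) := by
  induction r with
  | zero =>
    have := natCast_mul_sum_polyChar χ ψ 1
    simpa [sum_polyChar_zero, sum_polyChar_degree_one] using this.symm
  | succ r ih =>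
    have := natCast_mul_sum_polyChar χ ψ (r + 2)
    rw [sum_polyChar_eq_zero χ hψ (by omega), mul_zero, Finset.sum_Icc_succ_top (by omega),
      Finset.sum_Icc_succ_top (by omega), Finset.sum_eq_zero, Nat.sub_self, sum_polyChar_zero,
      show r + 1 + 1 - (r + 1) = 1 by omega, sum_polyChar_degree_one, ih] at this
    · rw [pow_succ]
      linear_combination -this
    · intro k hk
      rw [mem_Icc] at hk
      rw [sum_polyChar_eq_zero χ hψ (by omega), mul_zero]

variable {L : Type*} [Field L] [Fintype L] [Algebra F L]

open scoped Classical in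
lemma card_filter_minpoly_eq {P : F[X]} (hP : P ∈ monicIrreducibles F (Module.finrank F L)) :
    #{α : L | minpoly F α = P} = P.natDegree := by
  rw [mem_monicIrreducibles Module.finrank_pos.ne'] at hP
  obtain ⟨hm, hi, hd⟩ := hP
  have hsplit : (P.map (algebraMap F L)).Splits := by
    refine (FiniteField.isSplittingField_sub L F).splits.of_dvd ?_ ?_
    · exact map_ne_zero (FiniteField.X_pow_card_sub_X_ne_zero _ Fintype.one_lt_card)
    · refine (map_dvd_map' _).2 ?_
      rw [Module.card_eq_pow_finrank (K := F), ← Nat.card_eq_fintype_card]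
      exact hi.natDegree_dvd_iff_dvd_X_pow_card_pow_sub_X.1 hd
  rw [← card_rootSet_eq_natDegree (K := L) (PerfectField.separable_of_irreducible hi) hsplit,
    ← Set.toFinset_card]
  congr 1
  ext α
  simp only [mem_filter, mem_univ, true_and, Set.mem_toFinset, mem_rootSet, ne_eq, hm.ne_zero,
    not_false_eq_true]
  constructor
  · rintro rfl
    exact minpoly.aeval F α
  · intro h
    exact (minpoly.eq_of_irreducible_of_monic hi h hm).symm

/-- The **Hasse–Davenport lifting relation** for Gauss sums over finite fields. -/
theorem sum_trace_norm_eq (hψ : ψ ≠ 1) :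
    ∑ α : L, ψ (Algebra.trace F L α) * χ (Algebra.norm F α)
      = -(-gaussSum χ ψ) ^ Module.finrank F L := by
  classical
  have h0 : Module.finrank F L ≠ 0 := Module.finrank_pos.ne'
  obtain ⟨r, hr⟩ := Nat.exists_eq_succ_of_ne_zero h0
  have hmaps : ∀ α ∈ (univ : Finset L), minpoly F α ∈ monicIrreducibles F (Module.finrank F L) := by
    intro α _
    rw [mem_monicIrreducibles h0]
    have hi : IsIntegral F α := .of_finite F α
    exact ⟨minpoly.monic hi, minpoly.irreducible hi, minpoly.degree_dvd hi⟩
  rw [← Finset.sum_fiberwise_of_maps_to hmaps]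
  have : ∑ P ∈ monicIrreducibles F (Module.finrank F L),
      ∑ α : L with minpoly F α = P, ψ (Algebra.trace F L α) * χ (Algebra.norm F α)
      = irredPowerSum χ ψ (Module.finrank F L) := by
    refine Finset.sum_congr rfl fun P hP => ?_
    rw [← card_filter_minpoly_eq (L := L) hP, ← nsmul_eq_mul]
    refine Finset.sum_eq_card_nsmul fun α hα => ?_
    rw [mem_filter] at hα
    rw [card_filter_minpoly_eq hP, ← polyChar_minpoly_pow, hα.2]
  rw [this, hr, irredPowerSum_succ χ hψ]

end HasseDavenport

section NormLift

open Finset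

variable {F : Type*} [Field F] (L : Type*) [Field L] [Algebra F L]

/-- The multiplicative character `χ ∘ N_{L/F}` of `L` attached to a multiplicative character
`χ` of `F`. -/
noncomputable def MulChar.normLift [FiniteDimensional F L] : MulChar F ℂ →* MulChar L ℂ where
  toFun χ :=
    { toMonoidHom := (χ : F →* ℂ).comp (Algebra.norm F)
      map_nonunit' := fun a ha => by
        rw [isUnit_iff_ne_zero, not_not] at ha
        subst ha
        simp [Algebra.norm_zero] }
  map_one' := by
    ext a
    have : IsUnit (Algebra.norm F (a : L)) := a.isUnit.map _
    simpa using MulChar.one_apply this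
  map_mul' χ₁ χ₂ := by
    ext a
    rfl

lemma MulChar.normLift_apply [FiniteDimensional F L] (χ : MulChar F ℂ) (a : L) :
    MulChar.normLift L χ a = χ (Algebra.norm F a) := rfl

lemma MulChar.normLift_injective [Finite L] [FiniteDimensional F L] :
    Function.Injective (MulChar.normLift (F := F) L) := by
  intro χ₁ χ₂ h
  refine MulChar.ext' fun a => ?_
  obtain ⟨b, rfl⟩ := FiniteField.norm_surjective F L a
  exact DFunLike.congr_fun h b

variable {L} [Fintype F] [Fintype L]

lemma gaussSum_normLift (χ : MulChar F ℂ) {ψ : AddChar F ℂ} (hψ : ψ ≠ 1) :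
    gaussSum (MulChar.normLift L χ)
      (ψ.compAddMonoidHom (Algebra.trace F L).toAddMonoidHom)
      = -(-gaussSum χ ψ) ^ Module.finrank F L := by
  rw [← sum_trace_norm_eq χ hψ]
  refine Finset.sum_congr rfl fun a _ => ?_
  rw [MulChar.normLift_apply, mul_comm]
  rfl

lemma AddChar.compAddMonoidHom_trace_ne_one {ψ : AddChar F ℂ} (hψ : ψ ≠ 1) :
    ψ.compAddMonoidHom (Algebra.trace F L).toAddMonoidHom ≠ 1 := by
  obtain ⟨t, ht⟩ := AddChar.ne_one_iff.1 hψ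
  obtain ⟨a, rfl⟩ := Algebra.trace_surjective F L t
  exact AddChar.ne_one_iff.2 ⟨a, ht⟩

lemma IsCyclic.card_filter_pow_eq_one {G : Type*} [CommGroup G] [IsCyclic G] [Fintype G]
    [DecidableEq G] {n : ℕ} (h : n ∣ Nat.card G) : #{g : G | g ^ n = 1} = n := by
  have := IsCyclic.card_powMonoidHom_ker (G := G) n
  rw [Nat.gcd_eq_right h] at this
  conv_rhs => rw [← this]
  rw [← Fintype.card_subtype, ← Nat.card_eq_fintype_card]
  rfl

open scoped Classical in
lemma card_mulChar_pow_eq_one {n : ℕ} (h : n ∣ Fintype.card F - 1) :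
    #{χ : MulChar F ℂ | χ ^ n = 1} = n := by
  obtain ⟨e⟩ := MulChar.mulEquiv_units F ℂ
  have : IsCyclic (MulChar F ℂ) := isCyclic_of_surjective e.symm e.symm.surjective
  refine IsCyclic.card_filter_pow_eq_one ?_
  rwa [Nat.card_congr e.toEquiv, Nat.card_eq_fintype_card, Fintype.card_units]

open scoped Classical in
lemma card_filter_pow_eq_pow {n : ℕ} (h : n ∣ Fintype.card L - 1) {v : L} (hv : v ≠ 0) :
    #{y : L | y ^ n = v ^ n} = n := by
  have hn : n ≠ 0 := by
    rintro rfl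
    have := Fintype.one_lt_card (α := L)
    rw [zero_dvd_iff] at h
    omega
  have h' : n ∣ Nat.card Lˣ := by rwa [Nat.card_eq_fintype_card, Fintype.card_units]
  conv_rhs => rw [← IsCyclic.card_filter_pow_eq_one h']
  symm
  refine Finset.card_bij (fun g _ => (g : L) * v) ?_ ?_ ?_
  · intro g hg
    simp only [mem_filter, mem_univ, true_and] at hg ⊢
    rw [mul_pow, ← Units.val_pow_eq_pow_val, hg, Units.val_one, one_mul]
  · intro g _ g' _ hgg
    exact Units.ext (mul_right_cancel₀ hv hgg)
  · intro y hy
    simp only [mem_filter, mem_univ, true_and] at hy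
    have hy0 : y ≠ 0 := by
      rintro rfl
      rw [zero_pow hn] at hy
      exact pow_ne_zero n hv hy.symm
    refine ⟨Units.mk0 (y / v) (div_ne_zero hy0 hv), ?_, by simp [hv]⟩
    simp only [mem_filter, mem_univ, true_and]
    ext
    simp [div_pow, hy, hv]

lemma card_sub_one_dvd_card_sub_one : Fintype.card F - 1 ∣ Fintype.card L - 1 := by
  rw [Module.card_eq_pow_finrank (K := F) (V := L)]
  exact Nat.sub_one_dvd_pow_sub_one _ _

/-- If `u` is killed by all characters of order dividing `n` lifted from `F`,
then `u` is an `n`-th power. -/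
lemma exists_eq_pow_of_normLift_eq_one {n : ℕ} (h : n ∣ Fintype.card F - 1) {u : L} (hu : u ≠ 0)
    (hχ : ∀ χ : MulChar F ℂ, χ ^ n = 1 → MulChar.normLift L χ u = 1) :
    ∃ v : L, v ^ n = u := by
  have hn : n ≠ 0 := by
    rintro rfl
    have := Fintype.one_lt_card (α := F)
    rw [zero_dvd_iff] at h
    omega
  obtain ⟨χ, hord⟩ := MulChar.exists_mulChar_orderOf F h (Complex.isPrimitiveRoot_exp n hn)
  obtain ⟨g, hg⟩ := IsCyclic.exists_generator (α := Lˣ)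
  have hmem : Units.mk0 u hu ∈ Submonoid.powers g := by
    rw [mem_powers_iff_mem_zpowers]
    exact hg _
  obtain ⟨a, ha⟩ := hmem
  have hua : u = (g : L) ^ a := by
    have := congrArg Units.val ha
    simpa using this.symm
  have h1 : MulChar.normLift L χ u = 1 := hχ χ (by rw [← hord, pow_orderOf_eq_one])
  have h2 : MulChar.normLift L (χ ^ a) = 1 := by
    rw [MulChar.eq_iff hg, map_pow, MulChar.pow_apply_coe, ← map_pow, ← hua, h1]
    exact (MulChar.one_apply_coe g).symm
  have h3 : χ ^ a = 1 := MulChar.normLift_injective L (h2.trans (map_one _).symm)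
  obtain ⟨b, rfl⟩ : n ∣ a := by
    rw [← hord]
    exact orderOf_dvd_of_pow_eq_one h3
  exact ⟨(g : L) ^ b, by rw [hua, ← pow_mul, mul_comm]⟩

open scoped Classical in
lemma card_filter_pow_eq {n : ℕ} (h : n ∣ Fintype.card F - 1) (u : L) :
    (#{y : L | y ^ n = u} : ℂ)
      = 1 + ∑ χ : MulChar F ℂ with χ ≠ 1 ∧ χ ^ n = 1, MulChar.normLift L χ u := by
  have hn : n ≠ 0 := by
    rintro rfl
    have := Fintype.one_lt_card (α := F)
    rw [zero_dvd_iff] at h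
    omega
  rcases eq_or_ne u 0 with rfl | hu
  · have : ({y : L | y ^ n = 0} : Finset L) = {0} := by
      ext y
      simp [hn]
    rw [this, Finset.sum_eq_zero]
    · simp
    · intro χ _
      exact MulChar.map_zero _
  have hsplit : (univ.filter fun χ : MulChar F ℂ => χ ^ n = 1)
      = insert 1 (univ.filter fun χ : MulChar F ℂ => χ ≠ 1 ∧ χ ^ n = 1) := by
    ext χ
    by_cases hχ : χ = 1 <;> simp [hχ]
  have hsum : 1 + ∑ χ : MulChar F ℂ with χ ≠ 1 ∧ χ ^ n = 1, MulChar.normLift L χ u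
      = ∑ χ : MulChar F ℂ with χ ^ n = 1, MulChar.normLift L χ u := by
    rw [hsplit, Finset.sum_insert (by simp), map_one, MulChar.one_apply hu.isUnit]
  rw [hsum]
  by_cases hχ : ∀ χ : MulChar F ℂ, χ ^ n = 1 → MulChar.normLift L χ u = 1
  · obtain ⟨v, rfl⟩ := exists_eq_pow_of_normLift_eq_one h hu hχ
    have hv : v ≠ 0 := by
      rintro rfl
      exact hu (zero_pow hn)
    rw [card_filter_pow_eq_pow (h.trans card_sub_one_dvd_card_sub_one) hv,
      Finset.sum_congr rfl (fun χ hχ' => hχ χ (mem_filter.1 hχ').2)]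
    simp [card_mulChar_pow_eq_one h]
  · push Not at hχ
    obtain ⟨η, hη, hηu⟩ := hχ
    have hempty : ({y : L | y ^ n = u} : Finset L) = ∅ := by
      rw [Finset.filter_eq_empty_iff]
      rintro v - rfl
      refine hηu ?_
      rw [map_pow, ← MulChar.pow_apply' _ hn, ← map_pow, hη, map_one,
        MulChar.one_apply (pow_ne_zero_iff hn |>.1 hu).isUnit]
    have key : ∑ χ : MulChar F ℂ with χ ^ n = 1, MulChar.normLift L χ u
        = MulChar.normLift L η u *
          ∑ χ : MulChar F ℂ with χ ^ n = 1, MulChar.normLift L χ u := by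
      rw [Finset.mul_sum]
      refine Finset.sum_bij' (fun χ _ => η⁻¹ * χ) (fun χ _ => η * χ) ?_ ?_ ?_ ?_ ?_
      · intro χ hχ
        simp only [mem_filter, mem_univ, true_and] at hχ ⊢
        rw [mul_pow, inv_pow, hη, hχ, inv_one, one_mul]
      · intro χ hχ
        simp only [mem_filter, mem_univ, true_and] at hχ ⊢
        rw [mul_pow, hη, hχ, one_mul]
      · intro χ _
        simp
      · intro χ _
        simp
      · intro χ _
        rw [← MulChar.mul_apply, ← map_mul, mul_inv_cancel_left]
    rw [hempty, card_empty, Nat.cast_zero]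
    have h0 : (1 - MulChar.normLift L η u) *
        ∑ χ : MulChar F ℂ with χ ^ n = 1, MulChar.normLift L χ u = 0 := by
      rw [sub_mul, one_mul, sub_eq_zero]
      exact key
    exact ((mul_eq_zero.1 h0).resolve_left (sub_ne_zero.2 (Ne.symm hηu))).symm

end NormLift

section Curve

open Finset

lemma gaussSum'_eq_gaussSum {F : Type*} [Field F] [Fintype F] (φ : AddChar F ℂ)
    (χ : MulChar F ℂ) : gaussSum' φ χ = gaussSum χ φ := by
  rw [gaussSum', gaussSum]
  refine Finset.sum_of_injOn Units.val Units.val_injective.injOn (by simp) ?_ ?_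
  · intro x _ hx
    have : ¬ IsUnit x := fun h => hx ⟨h.unit, by simp, rfl⟩
    rw [MulChar.map_nonunit χ this, zero_mul]
  · intro x _
    rw [mul_comm]

lemma card_mul_jacobiSum_pow {L : Type*} [Field L] [Fintype L] {η : MulChar L ℂ} (hη : η ≠ 1)
    (hη5 : η ^ 5 = 1) {ψ : AddChar L ℂ} (hψ : ψ ≠ 1) :
    (Fintype.card L : ℂ) * jacobiSum (η ^ 4) (η ^ 3)
      = gaussSum (η ^ 3) ψ ^ 2 * gaussSum ((η ^ 3) ^ 3) ψ := by
  have hprim := AddChar.IsPrimitive.of_ne_one hψ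
  have h7 : η ^ 4 * η ^ 3 = η ^ 2 := by
    rw [← pow_add, show 4 + 3 = 5 + 2 from rfl, pow_add, hη5, one_mul]
  have h2 : η ^ 2 ≠ 1 := by
    intro h
    apply hη
    calc η = η ^ 5 * ((η ^ 2) ^ 2)⁻¹ := by group
      _ = 1 := by rw [h, hη5]; simp
  have hinv : (η ^ 2)⁻¹ = η ^ 3 := by
    rw [inv_eq_iff_mul_eq_one, ← pow_add, hη5]
  have h9 : (η ^ 3) ^ 3 = η ^ 4 := by
    rw [← pow_mul, show 3 * 3 = 5 + 4 from rfl, pow_add, hη5, one_mul]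
  have hJ := jacobiSum_mul_nontrivial (χ := η ^ 4) (φ := η ^ 3) (h7 ▸ h2) ψ
  have hG := gaussSum_mul_gaussSum_eq_card h2 hprim
  have hneg : (η ^ 3) (-1) = 1 :=
    MulChar.val_neg_one_eq_one_of_odd_order (n := 5) (by decide)
      (by rw [← pow_mul, mul_comm, pow_mul, hη5, one_pow])
  have hflip := mul_gaussSum_inv_eq_gaussSum (η ^ 3) ψ
  rw [hneg, one_mul] at hflip
  rw [hinv, hflip] at hG
  rw [h7] at hJ
  rw [h9, ← hG]
  linear_combination gaussSum (η ^ 3) ψ * hJ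

variable {F L : Type*} [Field F] [Fintype F] [Field L] [Fintype L] [Algebra F L]

open scoped Classical in
theorem card_curve_eq (h5 : 5 ∣ Fintype.card F - 1) {ψ : AddChar F ℂ} (hψ : ψ ≠ 1) :
    (Nat.card {pt : L × L // pt.2 ^ 5 = pt.1 ^ 4 * (1 - pt.1) ^ 3} : ℂ)
      = (Fintype.card F : ℂ) ^ Module.finrank F L -
        ∑ χ : MulChar F ℂ with χ ≠ 1 ∧ χ ^ 5 = 1,
          (-(1 / (Fintype.card F : ℂ)) * gaussSum χ ψ ^ 2 * gaussSum (χ ^ 3) ψ)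
            ^ Module.finrank F L := by
  have hcard : (Fintype.card L : ℂ) = (Fintype.card F : ℂ) ^ Module.finrank F L := by
    exact_mod_cast Module.card_eq_pow_finrank (K := F) (V := L)
  have hq : (Fintype.card F : ℂ) ≠ 0 := by
    exact_mod_cast Fintype.card_ne_zero
  have hfib : Nat.card {pt : L × L // pt.2 ^ 5 = pt.1 ^ 4 * (1 - pt.1) ^ 3}
      = ∑ x : L, #{y : L | y ^ 5 = x ^ 4 * (1 - x) ^ 3} := by
    rw [Nat.card_eq_fintype_card, Fintype.card_subtype, Finset.card_filter,
      Fintype.sum_prod_type]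
    simp only [Finset.card_filter]
  have hjac (χ : MulChar F ℂ) : ∑ x : L, MulChar.normLift L χ (x ^ 4 * (1 - x) ^ 3)
      = jacobiSum (MulChar.normLift L χ ^ 4) (MulChar.normLift L χ ^ 3) := by
    refine Finset.sum_congr rfl fun x _ => ?_
    rw [map_mul, map_pow, map_pow, MulChar.pow_apply' _ (by decide),
      MulChar.pow_apply' _ (by decide)]
  rw [hfib, Nat.cast_sum, Finset.sum_congr rfl fun x _ => card_filter_pow_eq h5 _,
    Finset.sum_add_distrib, Finset.sum_comm, Finset.sum_congr rfl fun χ _ => hjac χ]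
  rw [Finset.sum_const, card_univ, nsmul_eq_mul, mul_one, hcard, sub_eq_add_neg, add_right_inj,
    ← Finset.sum_neg_distrib]
  have hpow (a b : ℕ) (χ : MulChar F ℂ) (hχ : χ ^ 5 = 1) (hab : a * b = 6) :
      (χ ^ a) ^ b = χ := by
    rw [← pow_mul, hab, pow_succ, hχ, one_mul]
  have hmem (a b : ℕ) (hab : a * b = 6) (χ : MulChar F ℂ)
      (hχ : χ ∈ univ.filter fun χ : MulChar F ℂ => χ ≠ 1 ∧ χ ^ 5 = 1) :
      χ ^ a ∈ univ.filter fun χ : MulChar F ℂ => χ ≠ 1 ∧ χ ^ 5 = 1 := by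
    simp only [mem_filter, mem_univ, true_and] at hχ ⊢
    refine ⟨fun h => hχ.1 ?_, by rw [← pow_mul, mul_comm, pow_mul, hχ.2, one_pow]⟩
    rw [← hpow a b χ hχ.2 hab, h, one_pow]
  refine Finset.sum_bij' (fun χ _ => χ ^ 3) (fun χ _ => χ ^ 2) (hmem 3 2 rfl) (hmem 2 3 rfl)
    ?_ ?_ ?_
  · intro χ hχ
    exact hpow 3 2 χ (mem_filter.1 hχ).2.2 rfl
  · intro χ hχ
    exact hpow 2 3 χ (mem_filter.1 hχ).2.2 rfl
  · intro χ hχ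
    simp only [mem_filter, mem_univ, true_and] at hχ
    have hη : MulChar.normLift L χ ≠ 1 := by
      rw [← map_one (MulChar.normLift (F := F) L)]
      exact (MulChar.normLift_injective L).ne hχ.1
    have hη5 : MulChar.normLift L χ ^ 5 = 1 := by rw [← map_pow, hχ.2, map_one]
    have hJ := card_mul_jacobiSum_pow hη hη5 (AddChar.compAddMonoidHom_trace_ne_one (L := L) hψ)
    rw [← map_pow _ χ 3, ← map_pow _ (χ ^ 3) 3, gaussSum_normLift _ hψ, gaussSum_normLift _ hψ,
      map_pow _ χ 3, hcard] at hJ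
    have hqr := pow_ne_zero (Module.finrank F L) hq
    apply mul_left_cancel₀ hqr
    rw [hJ]
    have : (Fintype.card F : ℂ) * (-(1 / (Fintype.card F : ℂ)) * gaussSum (χ ^ 3) ψ ^ 2 *
        gaussSum ((χ ^ 3) ^ 3) ψ)
        = (-gaussSum (χ ^ 3) ψ) ^ 2 * -gaussSum ((χ ^ 3) ^ 3) ψ := by
      field_simp
    rw [mul_neg, mul_neg, ← mul_pow, this, mul_pow, neg_sq, pow_right_comm]

end Curve

open scoped Classical in
/-- Let `F_q = GF(p^n)` with `q ≡ 1 (mod 5)` and `p ≠ 5` prime, let `φ'`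
be a nontrivial additive character of `F_p = ZMod p` with values in `ℂ`, and let
`φ₁ = φ' ∘ Tr_{F_q/F_p}`. Then for every `r ≥ 1` the number of pairs
`(x, y) ∈ F_{q^r} × F_{q^r}` (where `F_{q^r} = GF(p^{nr})`) with `y⁵ = x⁴(1-x)³` equals
`q^r - ∑_χ (-(1/q) G(φ₁,χ)² G(φ₁,χ³))^r`, the sum running over all nontrivial
multiplicative characters `χ` of `F_q` with `χ⁵ = 1`. -/
theorem stmt_4 (p : ℕ) [Fact p.Prime] (hp5 : p ≠ 5) (n : ℕ) (hn : n ≠ 0)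
    (hq : Fintype.card (GaloisField p n) % 5 = 1)
    (φ' : AddChar (ZMod p) ℂ) (hφ' : φ' ≠ 1) :
    ∀ r : ℕ, 1 ≤ r →
      (Nat.card {pt : GaloisField p (n * r) × GaloisField p (n * r) //
          pt.2 ^ 5 = pt.1 ^ 4 * (1 - pt.1) ^ 3} : ℂ) =
        (Fintype.card (GaloisField p n) : ℂ) ^ r -
          ∑ χ ∈ Finset.univ.filter
              (fun χ : MulChar (GaloisField p n) ℂ => χ ≠ 1 ∧ χ ^ 5 = 1),
            (-(1 / (Fintype.card (GaloisField p n) : ℂ)) *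
                gaussSum' (φ'.compAddMonoidHom
                  (Algebra.trace (ZMod p) (GaloisField p n)).toAddMonoidHom) χ ^ 2 *
                gaussSum' (φ'.compAddMonoidHom
                  (Algebra.trace (ZMod p) (GaloisField p n)).toAddMonoidHom) (χ ^ 3)) ^ r := by
  intro r hr
  have hFcard : Fintype.card (GaloisField p n) - 1 = 5 * (Fintype.card (GaloisField p n) / 5) := by
    omega
  have hfinrank : Module.finrank (ZMod p) (GaloisField p (n * r))
      = Module.finrank (ZMod p) (GaloisField p n) * r := by
    rw [GaloisField.finrank p hn, GaloisField.finrank p (Nat.mul_ne_zero hn (by omega))]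
  obtain ⟨f⟩ : Nonempty (GaloisField p n →ₐ[ZMod p] GaloisField p (n * r)) :=
    FiniteField.nonempty_algHom_of_finrank_dvd (hfinrank ▸ dvd_mul_right _ _)
  algebraize [f.toRingHom]
  have : IsScalarTower (ZMod p) (GaloisField p n) (GaloisField p (n * r)) :=
    IsScalarTower.of_algHom f
  have hr' : Module.finrank (GaloisField p n) (GaloisField p (n * r)) = r := by
    rw [← Module.finrank_mul_finrank (ZMod p) (GaloisField p n)] at hfinrank
    exact Nat.eq_of_mul_eq_mul_left Module.finrank_pos hfinrank
  have hmain := card_curve_eq (L := GaloisField p (n * r)) ⟨_, hFcard⟩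
    (AddChar.compAddMonoidHom_trace_ne_one (L := GaloisField p n) hφ')
  rw [hr'] at hmain
  simp only [gaussSum'_eq_gaussSum]
  convert hmain
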